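/- For every real x, the matrices 𝓛₁(x + 1/2) and 𝓛₂(x + 1/2) are invertible with inverses [𝓛₁(x + 1/2)]^{−1} = 𝓓·P[−x]·𝓛 and [𝓛₂(x + 1/2)]^{−1} = 𝓛·𝓓·P[−x]. In particular, 𝓛₁(0)^{−1} = 𝓓·P[1/2]·𝓛, 𝓛₂(0)^{−1} = 𝓛·𝓓·P[1/2], [𝓛₁(1/2)]^{−1} = 𝓓·𝓛, and [𝓛₂(1/2)]^{−1} = 𝓛·𝓓. -/

import Mathlib

noncomputable section

/-- `Eu x k` is the Euler polynomial `E_k(x)`, characterized by the generating function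
`(2/(e^z+1)) e^{xz} = Σ_k E_k(x) z^k / k!` for `|z| < π`. -/
def IsEulerFamily (Eu : ℝ → ℕ → ℝ) : Prop :=
  ∀ x z : ℝ, |z| < Real.pi →
    HasSum (fun k : ℕ => Eu x k * z ^ k / (Nat.factorial k : ℝ))
      (2 / (Real.exp z + 1) * Real.exp (x * z))

/-- The `(n+1)×(n+1)` Euler polynomial matrix `𝓔(x)`, with `(i,j)` entry
`C(i,j) E_{i-j}(x)` (which is `0` for `j > i` since then `C(i,j) = 0`). -/
def eulerMatrix (Eu : ℝ → ℕ → ℝ) (n : ℕ) (x : ℝ) :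
    Matrix (Fin (n + 1)) (Fin (n + 1)) ℝ :=
  Matrix.of fun i j => (Nat.choose (i : ℕ) (j : ℕ) : ℝ) * Eu x ((i : ℕ) - (j : ℕ))

/-- The generalized Pascal matrix of the first kind `P[x]`. -/
def pascalMatrix (n : ℕ) (x : ℝ) : Matrix (Fin (n + 1)) (Fin (n + 1)) ℝ :=
  Matrix.of fun i j => (Nat.choose (i : ℕ) (j : ℕ) : ℝ) * x ^ ((i : ℕ) - (j : ℕ))

/-- The matrix `𝓓`, with `(i,j)` entry `(1+(-1)^(i-j)) C(i,j) 2^(j-i-1)`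
(which is `0` for `j > i` since then `C(i,j) = 0`). -/
def Dmatrix (n : ℕ) : Matrix (Fin (n + 1)) (Fin (n + 1)) ℝ :=
  Matrix.of fun i j =>
    (1 + (-1 : ℝ) ^ ((i : ℤ) - (j : ℤ))) * (Nat.choose (i : ℕ) (j : ℕ) : ℝ) *
      (2 : ℝ) ^ ((j : ℤ) - (i : ℤ) - 1)

/-- The Lucas sequence: `L_1 = 1`, `L_2 = 3`, `L_{m+2} = L_{m+1} + L_m` (so `L_0 = 2`). -/
def lucasSeq : ℕ → ℕ
  | 0 => 2
  | 1 => 1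
  | m + 2 => lucasSeq (m + 1) + lucasSeq m

/-- The `(n+1)×(n+1)` Lucas matrix `𝓛`, with `(i,j)` entry `L_{i-j+1}` for `i ≥ j`
and `0` otherwise. -/
def lucasMatrix (n : ℕ) : Matrix (Fin (n + 1)) (Fin (n + 1)) ℝ :=
  Matrix.of fun i j =>
    if (j : ℕ) ≤ (i : ℕ) then (lucasSeq ((i : ℕ) - (j : ℕ) + 1) : ℝ) else 0

/-- The matrix `𝓛₁(x)`, with `(i,j)` entry
`C(i,j) E_{i-j}(x) - 3 C(i-1,j) E_{i-j-1}(x)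
  + 5 Σ_{k=j}^{i-2} (-1)^{i-k} 2^{i-k-2} C(k,j) E_{k-j}(x)`,
where terms with vanishing binomial coefficient are `0` and empty sums are `0`. -/
def L1matrix (Eu : ℝ → ℕ → ℝ) (n : ℕ) (x : ℝ) :
    Matrix (Fin (n + 1)) (Fin (n + 1)) ℝ :=
  Matrix.of fun i j =>
    (Nat.choose (i : ℕ) (j : ℕ) : ℝ) * Eu x ((i : ℕ) - (j : ℕ))
    - 3 * (if 1 ≤ (i : ℕ) then
        (Nat.choose ((i : ℕ) - 1) (j : ℕ) : ℝ) * Eu x ((i : ℕ) - 1 - (j : ℕ)) else 0)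
    + 5 * ∑ k ∈ Finset.Ico (j : ℕ) ((i : ℕ) - 1),
        (-1 : ℝ) ^ ((i : ℕ) - k) * 2 ^ ((i : ℕ) - k - 2) *
          (Nat.choose k (j : ℕ) : ℝ) * Eu x (k - (j : ℕ))

/-- The matrix `𝓛₂(x)`, with `(i,j)` entry
`C(i,j) E_{i-j}(x) - 3 C(i,j+1) E_{i-j-1}(x)
  + 5 Σ_{k=j+2}^{i} (-1)^{k-j} 2^{k-j-2} C(i,k) E_{i-k}(x)`,
where terms with vanishing binomial coefficient are `0` and empty sums are `0`. -/
def L2matrix (Eu : ℝ → ℕ → ℝ) (n : ℕ) (x : ℝ) :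
    Matrix (Fin (n + 1)) (Fin (n + 1)) ℝ :=
  Matrix.of fun i j =>
    (Nat.choose (i : ℕ) (j : ℕ) : ℝ) * Eu x ((i : ℕ) - (j : ℕ))
    - 3 * (Nat.choose (i : ℕ) ((j : ℕ) + 1) : ℝ) * Eu x ((i : ℕ) - ((j : ℕ) + 1))
    + 5 * ∑ k ∈ Finset.Icc ((j : ℕ) + 2) (i : ℕ),
        (-1 : ℝ) ^ (k - (j : ℕ)) * 2 ^ (k - (j : ℕ) - 2) *
          (Nat.choose (i : ℕ) k : ℝ) * Eu x ((i : ℕ) - k)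


namespace EulerLucas

open PowerSeries

/-- `f` represents `F` on the interval `|z| < π`. -/
def Rep (f : PowerSeries ℝ) (F : ℝ → ℝ) : Prop :=
  ∀ z : ℝ, |z| < Real.pi → HasSum (fun k : ℕ => coeff k f * z ^ k) (F z)

theorem hasSum_congr' {f g : ℕ → ℝ} {a b : ℝ} (h : HasSum f a) (hab : b = a)
    (hfg : ∀ k, g k = f k) : HasSum g b := by
  rw [hab, show g = f from funext hfg]
  exact h

theorem Rep.mul {f g : PowerSeries ℝ} {F G : ℝ → ℝ} (hf : Rep f F) (hg : Rep g G) :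
    Rep (f * g) (fun z => F z * G z) := by
  intro z hz
  have h1 := hf z hz
  have h2 := hg z hz
  have n1 := summable_norm_iff.mpr h1.summable
  have n2 := summable_norm_iff.mpr h2.summable
  have h3 := tsum_mul_tsum_eq_tsum_sum_antidiagonal_of_summable_norm n1 n2
  have h4 := (summable_norm_sum_mul_antidiagonal_of_summable_norm n1 n2).of_norm.hasSum
  rw [← h3, h1.tsum_eq, h2.tsum_eq] at h4
  refine hasSum_congr' h4 rfl fun k => ?_
  rw [coeff_mul, Finset.sum_mul]
  refine Finset.sum_congr rfl fun p hp => ?_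
  rw [← Finset.HasAntidiagonal.mem_antidiagonal.mp hp, pow_add]
  ring

theorem Rep.unique {f g : PowerSeries ℝ} {F : ℝ → ℝ} (hf : Rep f F) (hg : Rep g F) : f = g := by
  have key : ∀ f : PowerSeries ℝ, Rep f F → HasFPowerSeriesAt F
      (FormalMultilinearSeries.ofScalars ℝ (fun k => coeff k f)) 0 := by
    intro f hf
    rw [hasFPowerSeriesAt_iff]
    have : ∀ᶠ z in nhds (0 : ℝ), |z| < Real.pi := by
      have := Metric.ball_mem_nhds (0 : ℝ) Real.pi_pos
      filter_upwards [this] with z hz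
      simpa using hz
    filter_upwards [this] with z hz
    have := hf z hz
    simpa [FormalMultilinearSeries.coeff_ofScalars, mul_comm] using this
  have h := (key f hf).eq_formalMultilinearSeries (key g hg)
  ext k
  have := congrArg (fun p => FormalMultilinearSeries.coeff p k) h
  simpa [FormalMultilinearSeries.coeff_ofScalars] using this

/-- exponential series `e^{xz}` -/
def pser (x : ℝ) : PowerSeries ℝ := PowerSeries.mk fun m => x ^ m / (m.factorial : ℝ)

theorem rep_pser (x : ℝ) : Rep (pser x) (fun z => Real.exp (x * z)) := by
  intro z _
  have := NormedSpace.expSeries_div_hasSum_exp (x * z)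
  rw [← Real.exp_eq_exp_ℝ] at this
  refine hasSum_congr' this rfl fun k => ?_
  simp [pser, mul_pow]
  ring

/-- the series of `cosh (z/2)` -/
def dser : PowerSeries ℝ :=
  PowerSeries.mk fun m => (1 + (-1 : ℝ) ^ m) * (2 : ℝ) ^ (-(m : ℤ) - 1) / (m.factorial : ℝ)

theorem rep_dser : Rep dser (fun z => (Real.exp (1 / 2 * z) + Real.exp (-(1 / 2) * z)) / 2) := by
  intro z hz
  have h := ((rep_pser (1/2) z hz).add (rep_pser (-(1/2)) z hz)).div_const 2
  refine hasSum_congr' h rfl fun k => ?_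
  have e : (2 : ℝ) ^ (-(k : ℤ) - 1) = (1/2) ^ k / 2 := by
    rw [zpow_sub₀ two_ne_zero, zpow_neg]; simp
  have e2 : (-(1/2) : ℝ) ^ k = (-1) ^ k * (1/2) ^ k := by rw [← mul_pow]; norm_num
  simp only [dser, pser, coeff_mk, e, e2]
  ring

/-- exponential series of the Euler polynomials -/
def eser (Eu : ℝ → ℕ → ℝ) (x : ℝ) : PowerSeries ℝ :=
  PowerSeries.mk fun m => Eu x m / (m.factorial : ℝ)

theorem eser_mul (Eu : ℝ → ℕ → ℝ) (hEu : IsEulerFamily Eu) (x : ℝ) :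
    eser Eu (x + 1 / 2) * (dser * pser (-x)) = 1 := by
  have he : Rep (eser Eu (x + 1/2))
      (fun z => 2 / (Real.exp z + 1) * Real.exp ((x + 1/2) * z)) := by
    intro z hz
    convert hEu (x + 1/2) z hz using 1
    funext k
    simp [eser]
    ring
  refine (he.mul (rep_dser.mul (rep_pser (-x)))).unique ?_
  intro z hz
  have : 2 / (Real.exp z + 1) * Real.exp ((x + 1/2) * z) *
      ((Real.exp (1 / 2 * z) + Real.exp (-(1 / 2) * z)) / 2 * Real.exp (-x * z)) = 1 := by
    have hp : Real.exp z + 1 ≠ 0 := by positivity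
    have e1 : Real.exp ((x + 1/2) * z) * Real.exp (-x * z) * Real.exp (1/2 * z) = Real.exp z := by
      rw [← Real.exp_add, ← Real.exp_add]; congr 1; ring
    have e2 : Real.exp ((x + 1/2) * z) * Real.exp (-x * z) * Real.exp (-(1/2) * z) = 1 := by
      rw [← Real.exp_add, ← Real.exp_add, ← Real.exp_zero]; congr 1; ring
    calc _ = (Real.exp ((x + 1/2) * z) * Real.exp (-x * z) * Real.exp (1/2 * z)
          + Real.exp ((x + 1/2) * z) * Real.exp (-x * z) * Real.exp (-(1/2) * z))
          / (Real.exp z + 1) := by ring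
      _ = 1 := by rw [e1, e2]; exact div_self hp
  have h := hasSum_ite_eq (0 : ℕ) (1 : ℝ)
  refine hasSum_congr' h this fun k => ?_
  rw [coeff_one]
  split_ifs with hk <;> simp [hk]

/-- Toeplitz matrix -/
def T (n : ℕ) (f : PowerSeries ℝ) : Matrix (Fin (n + 1)) (Fin (n + 1)) ℝ :=
  Matrix.of fun i j => if (j : ℕ) ≤ (i : ℕ) then coeff ((i : ℕ) - (j : ℕ)) f else 0

theorem T_mul (n : ℕ) (f g : PowerSeries ℝ) : T n f * T n g = T n (f * g) := by
  ext i j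
  rw [Matrix.mul_apply]
  simp only [T, Matrix.of_apply]
  rw [Fin.sum_univ_eq_sum_range (fun k => (if k ≤ (i : ℕ) then coeff ((i : ℕ) - k) f else 0) *
    (if (j : ℕ) ≤ k then coeff (k - (j : ℕ)) g else 0)) (n + 1)]
  have hi := i.2
  split_ifs with h
  · have : ∑ k ∈ Finset.Ico (j : ℕ) ((i : ℕ) + 1), coeff ((i : ℕ) - k) f * coeff (k - (j : ℕ)) g
        = coeff ((i : ℕ) - (j : ℕ)) (f * g) := by
      rw [Finset.sum_Ico_eq_sum_range, mul_comm f g, coeff_mul,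
        Finset.Nat.sum_antidiagonal_eq_sum_range_succ_mk]
      refine Finset.sum_congr (by congr 1; omega) fun k hk => ?_
      rw [mul_comm]
      simp [Nat.sub_add_eq]
    rw [← this]
    symm
    apply Finset.sum_subset_zero_on_sdiff
    · intro k; simp only [Finset.mem_Ico, Finset.mem_range]; omega
    · intro k; simp only [Finset.mem_sdiff, Finset.mem_Ico, Finset.mem_range]
      intro hk
      by_cases h1 : k ≤ (i : ℕ)
      · rw [if_neg (show ¬ (j : ℕ) ≤ k by omega), mul_zero]
      · rw [if_neg h1, zero_mul]
    · intro k; simp only [Finset.mem_Ico]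
      intro hk
      rw [if_pos (by omega), if_pos hk.1]
  · apply Finset.sum_eq_zero
    intro k _
    by_cases h1 : k ≤ (i : ℕ)
    · rw [if_neg (show ¬ (j : ℕ) ≤ k by omega), mul_zero]
    · rw [if_neg h1, zero_mul]

theorem T_one (n : ℕ) : T n 1 = 1 := by
  ext i j
  simp only [T, Matrix.of_apply, coeff_one, Matrix.one_apply, Fin.ext_iff]
  split_ifs <;> first | rfl | omega

/-- Binomial Toeplitz matrix -/
def A (n : ℕ) (f : PowerSeries ℝ) : Matrix (Fin (n + 1)) (Fin (n + 1)) ℝ :=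
  Matrix.diagonal (fun i : Fin (n + 1) => ((i : ℕ).factorial : ℝ)) * T n f *
    Matrix.diagonal (fun i : Fin (n + 1) => ((i : ℕ).factorial : ℝ)⁻¹)

theorem A_mul (n : ℕ) (f g : PowerSeries ℝ) : A n f * A n g = A n (f * g) := by
  have h : Matrix.diagonal (fun i : Fin (n + 1) => ((i : ℕ).factorial : ℝ)⁻¹) *
      Matrix.diagonal (fun i : Fin (n + 1) => ((i : ℕ).factorial : ℝ)) = 1 := by
    rw [Matrix.diagonal_mul_diagonal, ← Matrix.diagonal_one]
    congr 1
    funext i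
    exact inv_mul_cancel₀ (by positivity)
  unfold A
  rw [← T_mul]
  simp only [Matrix.mul_assoc]
  rw [← Matrix.mul_assoc (Matrix.diagonal _) (Matrix.diagonal _) (T n g * _), h, Matrix.one_mul]

theorem A_one (n : ℕ) : A n 1 = 1 := by
  unfold A
  rw [T_one, Matrix.mul_one, Matrix.diagonal_mul_diagonal, ← Matrix.diagonal_one]
  congr 1
  funext i
  exact mul_inv_cancel₀ (by positivity)

theorem A_apply (n : ℕ) (f : PowerSeries ℝ) (i j : Fin (n + 1)) :
    A n f i j = (Nat.choose (i : ℕ) (j : ℕ) : ℝ) *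
      (coeff ((i : ℕ) - (j : ℕ)) f * (((i : ℕ) - (j : ℕ)).factorial : ℝ)) := by
  unfold A
  rw [Matrix.mul_diagonal, Matrix.diagonal_mul]
  simp only [T, Matrix.of_apply]
  split_ifs with h
  · rw [Nat.cast_choose ℝ h]
    field_simp
  · rw [Nat.choose_eq_zero_of_lt (by omega)]; simp

theorem pascal_eq (n : ℕ) (x : ℝ) : pascalMatrix n x = A n (pser x) := by
  ext i j
  rw [A_apply]
  simp only [pascalMatrix, pser, Matrix.of_apply, coeff_mk]
  field_simp

theorem euler_eq (Eu : ℝ → ℕ → ℝ) (n : ℕ) (x : ℝ) : eulerMatrix Eu n x = A n (eser Eu x) := by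
  ext i j
  rw [A_apply]
  simp only [eulerMatrix, eser, Matrix.of_apply, coeff_mk]
  field_simp

theorem D_eq (n : ℕ) : Dmatrix n = A n dser := by
  ext i j
  rw [A_apply]
  simp only [Dmatrix, dser, Matrix.of_apply, coeff_mk]
  by_cases h : (j : ℕ) ≤ (i : ℕ)
  · have e : (i : ℤ) - (j : ℤ) = (((i : ℕ) - (j : ℕ) : ℕ) : ℤ) := by omega
    have e' : (j : ℤ) - (i : ℤ) = -(((i : ℕ) - (j : ℕ) : ℕ) : ℤ) := by omega
    rw [e, e', zpow_natCast]
    field_simp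
  · rw [Nat.choose_eq_zero_of_lt (by omega)]; simp

/-- Lucas series -/
def lser : PowerSeries ℝ := PowerSeries.mk fun m => (lucasSeq (m + 1) : ℝ)

/-- coefficients of the inverse of the Lucas series -/
def linv : ℕ → ℝ
  | 0 => 1
  | 1 => -3
  | m + 2 => 5 * ((-1) ^ m * 2 ^ m)

theorem lser_mul : lser * PowerSeries.mk linv = 1 := by
  have h1 : lser * (1 - X - X * X) = 1 + (X + X) := by
    rw [mul_sub, mul_sub, mul_one, ← mul_assoc]
    ext k
    rcases k with _ | _ | k
    · simp [lser, lucasSeq]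
    · simp only [map_sub, map_add, coeff_succ_mul_X, coeff_zero_mul_X, lser, coeff_mk, coeff_one,
        coeff_X, lucasSeq]
      norm_num
    · simp only [map_sub, map_add, coeff_succ_mul_X, lser, coeff_mk, coeff_one,
        coeff_X, lucasSeq]
      push_cast
      simp
  have h2 : PowerSeries.mk linv * (1 + (X + X)) = 1 - X - X * X := by
    rw [mul_add, mul_add, mul_one]
    ext k
    rcases k with _ | _ | _ | k
    · simp [linv]
    · simp [linv, coeff_succ_mul_X, coeff_one, coeff_X]
      norm_num
    · simp [linv, coeff_succ_mul_X, coeff_one, coeff_X]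
      norm_num
    · simp [linv, coeff_succ_mul_X, coeff_one, coeff_X]
      ring
  have h3 : (1 + (X + X) : PowerSeries ℝ) ≠ 0 := by
    intro h
    have := congrArg (coeff 0) h
    simp at this
  apply mul_right_cancel₀ h3
  rw [mul_assoc, h2, h1, one_mul]

theorem lucas_eq (n : ℕ) : lucasMatrix n = T n lser := by
  ext i j
  simp [lucasMatrix, T, lser]

theorem L1_eq (Eu : ℝ → ℕ → ℝ) (n : ℕ) (x : ℝ) :
    L1matrix Eu n x = T n (PowerSeries.mk linv) * eulerMatrix Eu n x := by
  ext i j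
  rw [Matrix.mul_apply]
  simp only [T, Matrix.of_apply, eulerMatrix, L1matrix, coeff_mk]
  rw [Fin.sum_univ_eq_sum_range (fun k => (if k ≤ (i : ℕ) then linv ((i : ℕ) - k) else 0) *
    ((Nat.choose k (j : ℕ) : ℝ) * Eu x (k - (j : ℕ)))) (n + 1)]
  obtain ⟨i, hi⟩ := i
  obtain ⟨j, hj⟩ := j
  simp only
  rw [← Finset.sum_subset (Finset.range_subset_range.mpr (show i + 1 ≤ n + 1 by omega))
    (by
      intro k _ hk
      rw [Finset.mem_range] at hk
      rw [if_neg (by omega), zero_mul])]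
  rcases i with _ | _ | i
  · simp [linv]
  · simp [Finset.sum_range_succ, linv]
    ring
  · rw [Finset.sum_range_succ, Finset.sum_range_succ]
    have : ∑ k ∈ Finset.range (i + 1), (if k ≤ i + 1 + 1 then linv (i + 1 + 1 - k) else 0) *
        ((Nat.choose k j : ℝ) * Eu x (k - j)) = 5 * ∑ k ∈ Finset.Ico j (i + 1 + 1 - 1),
        (-1 : ℝ) ^ (i + 1 + 1 - k) * 2 ^ (i + 1 + 1 - k - 2) *
          (Nat.choose k j : ℝ) * Eu x (k - j) := by
      rw [Finset.mul_sum]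
      symm
      apply Finset.sum_subset_zero_on_sdiff
      · intro k; simp only [Finset.mem_Ico, Finset.mem_range]; omega
      · intro k; simp only [Finset.mem_sdiff, Finset.mem_Ico, Finset.mem_range]
        intro hk
        rw [Nat.choose_eq_zero_of_lt (by omega)]; simp
      · intro k; simp only [Finset.mem_Ico]
        intro hk
        obtain ⟨m, hm⟩ : ∃ m, i + 1 + 1 - k = m + 2 := ⟨i - k, by omega⟩
        rw [if_pos (by omega), hm]
        simp only [linv, Nat.add_sub_cancel, pow_add]
        ring
    rw [this]
    simp [linv]
    ring

theorem L2_eq (Eu : ℝ → ℕ → ℝ) (n : ℕ) (x : ℝ) :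
    L2matrix Eu n x = eulerMatrix Eu n x * T n (PowerSeries.mk linv) := by
  ext i j
  rw [Matrix.mul_apply]
  simp only [T, Matrix.of_apply, eulerMatrix, L2matrix, coeff_mk]
  rw [Fin.sum_univ_eq_sum_range (fun k => ((Nat.choose (i : ℕ) k : ℝ) * Eu x ((i : ℕ) - k)) *
    (if (j : ℕ) ≤ k then linv (k - (j : ℕ)) else 0)) (n + 1)]
  obtain ⟨i, hi⟩ := i
  obtain ⟨j, hj⟩ := j
  simp only
  have e : ∑ k ∈ Finset.range (n + 1), ((Nat.choose i k : ℝ) * Eu x (i - k)) *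
      (if j ≤ k then linv (k - j) else 0) =
      ∑ k ∈ Finset.Ico j (n + 3), ((Nat.choose i k : ℝ) * Eu x (i - k)) * linv (k - j) := by
    have e1 : ∑ k ∈ Finset.range (n + 1), ((Nat.choose i k : ℝ) * Eu x (i - k)) *
        (if j ≤ k then linv (k - j) else 0) = ∑ k ∈ Finset.Ico j (n + 1),
        ((Nat.choose i k : ℝ) * Eu x (i - k)) * linv (k - j) := by
      symm
      apply Finset.sum_subset_zero_on_sdiff
      · intro k; simp only [Finset.mem_Ico, Finset.mem_range]; omega
      · intro k; simp only [Finset.mem_sdiff, Finset.mem_Ico, Finset.mem_range]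
        intro hk
        rw [if_neg (by omega), mul_zero]
      · intro k; simp only [Finset.mem_Ico]
        intro hk
        rw [if_pos hk.1]
    rw [e1]
    apply Finset.sum_subset
    · intro k; simp only [Finset.mem_Ico]; omega
    · intro k; simp only [Finset.mem_Ico]
      intro hk hk2
      rw [Nat.choose_eq_zero_of_lt (by omega)]; simp
  rw [e, Finset.sum_eq_sum_Ico_succ_bot (by omega), Finset.sum_eq_sum_Ico_succ_bot (by omega)]
  have : ∑ k ∈ Finset.Ico (j + 1 + 1) (n + 3), ((Nat.choose i k : ℝ) * Eu x (i - k)) * linv (k - j)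
      = 5 * ∑ k ∈ Finset.Icc (j + 2) i, (-1 : ℝ) ^ (k - j) * 2 ^ (k - j - 2) *
          (Nat.choose i k : ℝ) * Eu x (i - k) := by
    rw [Finset.mul_sum]
    symm
    apply Finset.sum_subset_zero_on_sdiff
    · intro k; simp only [Finset.mem_Ico, Finset.mem_Icc]; omega
    · intro k; simp only [Finset.mem_sdiff, Finset.mem_Ico, Finset.mem_Icc]
      intro hk
      rw [Nat.choose_eq_zero_of_lt (by omega)]; simp
    · intro k; simp only [Finset.mem_Icc]
      intro hk
      obtain ⟨m, hm⟩ : ∃ m, k - j = m + 2 := ⟨k - j - 2, by omega⟩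
      rw [hm]
      simp only [linv, Nat.add_sub_cancel, pow_add]
      ring
  rw [this]
  simp [linv]
  ring

theorem main (Eu : ℝ → ℕ → ℝ) (hEu : IsEulerFamily Eu) (n : ℕ) (x : ℝ) :
    (L1matrix Eu n (x + 1 / 2) * (Dmatrix n * pascalMatrix n (-x) * lucasMatrix n) = 1 ∧
     (Dmatrix n * pascalMatrix n (-x) * lucasMatrix n) * L1matrix Eu n (x + 1 / 2) = 1) ∧
    (L2matrix Eu n (x + 1 / 2) * (lucasMatrix n * Dmatrix n * pascalMatrix n (-x)) = 1 ∧
     (lucasMatrix n * Dmatrix n * pascalMatrix n (-x)) * L2matrix Eu n (x + 1 / 2) = 1) := by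
  have hA : A n (eser Eu (x + 1/2)) * (A n dser * A n (pser (-x))) = 1 := by
    rw [A_mul, A_mul, eser_mul Eu hEu, A_one]
  have hT : T n lser * T n (PowerSeries.mk linv) = 1 := by rw [T_mul, lser_mul, T_one]
  have hA' := mul_eq_one_comm.mp hA
  have hT' := mul_eq_one_comm.mp hT
  have h1 : L1matrix Eu n (x + 1 / 2) *
      (Dmatrix n * pascalMatrix n (-x) * lucasMatrix n) = 1 := by
    rw [L1_eq, euler_eq, D_eq, pascal_eq, lucas_eq, Matrix.mul_assoc, ← Matrix.mul_assoc (A n _),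
      hA, Matrix.one_mul, hT']
  have h2 : L2matrix Eu n (x + 1 / 2) *
      (lucasMatrix n * Dmatrix n * pascalMatrix n (-x)) = 1 := by
    rw [L2_eq, euler_eq, D_eq, pascal_eq, lucas_eq, Matrix.mul_assoc (T n lser),
      Matrix.mul_assoc (A n (eser _ _)), ← Matrix.mul_assoc (T n _) (T n _),
      hT', Matrix.one_mul, hA]
  exact ⟨⟨h1, mul_eq_one_comm.mp h1⟩, ⟨h2, mul_eq_one_comm.mp h2⟩⟩

theorem pascal_zero (n : ℕ) : pascalMatrix n 0 = 1 := by
  have : pser 0 = 1 := by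
    ext k
    rw [coeff_one]
    simp only [pser, coeff_mk]
    rcases k with _ | k <;> simp
  rw [pascal_eq, this, A_one]

end EulerLucas

theorem L1L2_matrix_inverse (Eu : ℝ → ℕ → ℝ) (hEu : IsEulerFamily Eu) (n : ℕ) (x : ℝ) :
    (L1matrix Eu n (x + 1 / 2) * (Dmatrix n * pascalMatrix n (-x) * lucasMatrix n) = 1 ∧
     (Dmatrix n * pascalMatrix n (-x) * lucasMatrix n) * L1matrix Eu n (x + 1 / 2) = 1) ∧
    (L2matrix Eu n (x + 1 / 2) * (lucasMatrix n * Dmatrix n * pascalMatrix n (-x)) = 1 ∧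
     (lucasMatrix n * Dmatrix n * pascalMatrix n (-x)) * L2matrix Eu n (x + 1 / 2) = 1) ∧
    (L1matrix Eu n 0 * (Dmatrix n * pascalMatrix n (1 / 2) * lucasMatrix n) = 1 ∧
     (Dmatrix n * pascalMatrix n (1 / 2) * lucasMatrix n) * L1matrix Eu n 0 = 1) ∧
    (L2matrix Eu n 0 * (lucasMatrix n * Dmatrix n * pascalMatrix n (1 / 2)) = 1 ∧
     (lucasMatrix n * Dmatrix n * pascalMatrix n (1 / 2)) * L2matrix Eu n 0 = 1) ∧
    (L1matrix Eu n (1 / 2) * (Dmatrix n * lucasMatrix n) = 1 ∧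
     (Dmatrix n * lucasMatrix n) * L1matrix Eu n (1 / 2) = 1) ∧
    (L2matrix Eu n (1 / 2) * (lucasMatrix n * Dmatrix n) = 1 ∧
     (lucasMatrix n * Dmatrix n) * L2matrix Eu n (1 / 2) = 1) := by
  have h0 := EulerLucas.main Eu hEu n x
  have h1 := EulerLucas.main Eu hEu n (-(1 / 2))
  have h2 := EulerLucas.main Eu hEu n 0
  simp only [neg_neg, neg_add_cancel] at h1
  simp only [neg_zero, zero_add, EulerLucas.pascal_zero, Matrix.mul_one] at h2
  exact ⟨h0.1, h0.2, h1.1, h1.2, h2.1, h2.2⟩
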